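/- Let n ≥ 1, let φ, θ, ψ : ℝ → ℝ and ξ_j, ζ_j : ℝ → ℝ³ (j = 1,…,n) be differentiable, set ℛ(t) = R₃(φ(t)) R₁(θ(t)) R₃(ψ(t)), x_j(t) = ℛ(t) ξ_j(t), y_j(t) = ℛ(t) ζ_j(t), and C(t) = Σ_{j=1}^n x_j(t) × y_j(t). Then for every t, Σ_{j=1}^n y_j(t)·x_j'(t) = (C(t)·e₃*) φ'(t) + (C(t)·R₃(φ(t))e₁*) θ'(t) + (C(t)·R₃(φ(t))R₁(θ(t))e₃*) ψ'(t) + Σ_{j=1}^n ζ_j(t)·ξ_j'(t). -/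

import Mathlib

open Matrix

/-- Rotation matrix about the first coordinate axis. -/
noncomputable def R1 (α : ℝ) : Matrix (Fin 3) (Fin 3) ℝ :=
  !![1, 0, 0; 0, Real.cos α, -Real.sin α; 0, Real.sin α, Real.cos α]

/-- Rotation matrix about the third coordinate axis. -/
noncomputable def R3 (α : ℝ) : Matrix (Fin 3) (Fin 3) ℝ :=
  !![Real.cos α, -Real.sin α, 0; Real.sin α, Real.cos α, 0; 0, 0, 1]

/-- First standard basis vector of ℝ³. -/
def e1 : Fin 3 → ℝ := ![1, 0, 0]

/-- Third standard basis vector of ℝ³. -/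
def e3 : Fin 3 → ℝ := ![0, 0, 1]

theorem R1_mulVec (α : ℝ) (v : Fin 3 → ℝ) :
    R1 α *ᵥ v = ![v 0, Real.cos α * v 1 - Real.sin α * v 2, Real.sin α * v 1 + Real.cos α * v 2] := by
  ext i
  fin_cases i <;> simp [R1, mulVec, dotProduct, Fin.sum_univ_three, sub_eq_add_neg]

theorem R3_mulVec (α : ℝ) (v : Fin 3 → ℝ) :
    R3 α *ᵥ v = ![Real.cos α * v 0 - Real.sin α * v 1, Real.sin α * v 0 + Real.cos α * v 1, v 2] := by
  ext i
  fin_cases i <;> simp [R3, mulVec, dotProduct, Fin.sum_univ_three, sub_eq_add_neg]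

theorem R1_mulVec_crossProduct (α : ℝ) (v w : Fin 3 → ℝ) :
    R1 α *ᵥ crossProduct v w = crossProduct (R1 α *ᵥ v) (R1 α *ᵥ w) := by
  have h := Real.sin_sq_add_cos_sq α
  ext i
  fin_cases i <;> simp [R1_mulVec, cross_apply]
  · linear_combination -(v 1 * w 2 - v 2 * w 1) * h
  all_goals ring

theorem R3_mulVec_crossProduct (α : ℝ) (v w : Fin 3 → ℝ) :
    R3 α *ᵥ crossProduct v w = crossProduct (R3 α *ᵥ v) (R3 α *ᵥ w) := by
  have h := Real.sin_sq_add_cos_sq α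
  ext i
  fin_cases i <;> simp [R3_mulVec, cross_apply]
  · ring
  · ring
  · linear_combination -(v 0 * w 1 - v 1 * w 0) * h

theorem R1_mulVec_dotProduct_R1_mulVec (α : ℝ) (v w : Fin 3 → ℝ) :
    R1 α *ᵥ v ⬝ᵥ R1 α *ᵥ w = v ⬝ᵥ w := by
  simp only [R1_mulVec, dotProduct, Fin.sum_univ_three, cons_val]
  linear_combination (v 1 * w 1 + v 2 * w 2) * Real.sin_sq_add_cos_sq α

theorem R3_mulVec_dotProduct_R3_mulVec (α : ℝ) (v w : Fin 3 → ℝ) :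
    R3 α *ᵥ v ⬝ᵥ R3 α *ᵥ w = v ⬝ᵥ w := by
  simp only [R3_mulVec, dotProduct, Fin.sum_univ_three, cons_val]
  linear_combination (v 0 * w 0 + v 1 * w 1) * Real.sin_sq_add_cos_sq α

theorem HasDerivAt.R1_mulVec {α : ℝ → ℝ} {v : ℝ → Fin 3 → ℝ} {α' t : ℝ} {v' : Fin 3 → ℝ}
    (hα : HasDerivAt α α' t) (hv : HasDerivAt v v' t) :
    HasDerivAt (fun s => R1 (α s) *ᵥ v s)
      (R1 (α t) *ᵥ v' + α' • crossProduct e1 (R1 (α t) *ᵥ v t)) t := by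
  rw [hasDerivAt_pi] at hv ⊢
  simp only [_root_.R1_mulVec, Fin.forall_fin_succ, IsEmpty.forall_iff, and_true]
  refine ⟨?_, ?_, ?_⟩
  · refine HasDerivAt.congr_deriv (hv 0) ?_
    simp [e1, cross_apply]
  · refine HasDerivAt.congr_deriv ((hα.cos.mul (hv 1)).sub (hα.sin.mul (hv 2))) ?_
    simp [e1, cross_apply]
    ring
  · refine HasDerivAt.congr_deriv ((hα.sin.mul (hv 1)).add (hα.cos.mul (hv 2))) ?_
    simp [e1, cross_apply]
    ring

theorem HasDerivAt.R3_mulVec {α : ℝ → ℝ} {v : ℝ → Fin 3 → ℝ} {α' t : ℝ} {v' : Fin 3 → ℝ}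
    (hα : HasDerivAt α α' t) (hv : HasDerivAt v v' t) :
    HasDerivAt (fun s => R3 (α s) *ᵥ v s)
      (R3 (α t) *ᵥ v' + α' • crossProduct e3 (R3 (α t) *ᵥ v t)) t := by
  rw [hasDerivAt_pi] at hv ⊢
  simp only [_root_.R3_mulVec, Fin.forall_fin_succ, IsEmpty.forall_iff, and_true]
  refine ⟨?_, ?_, ?_⟩
  · refine HasDerivAt.congr_deriv ((hα.cos.mul (hv 0)).sub (hα.sin.mul (hv 1))) ?_
    simp [e3, cross_apply]
    ring
  · refine HasDerivAt.congr_deriv ((hα.sin.mul (hv 0)).add (hα.cos.mul (hv 1))) ?_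
    simp [e3, cross_apply]
    ring
  · refine HasDerivAt.congr_deriv (hv 2) ?_
    simp [e3, cross_apply]

/-- The single-particle form of the identity, with the rotation given by its Euler angles. -/
theorem dotProduct_deriv_euler_mulVec {φ θ ψ : ℝ → ℝ} {ξ : ℝ → Fin 3 → ℝ} {t : ℝ}
    (hφ : DifferentiableAt ℝ φ t) (hθ : DifferentiableAt ℝ θ t) (hψ : DifferentiableAt ℝ ψ t)
    (hξ : DifferentiableAt ℝ ξ t) (ζ : Fin 3 → ℝ) {x : ℝ → Fin 3 → ℝ} {y : Fin 3 → ℝ}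
    (hx : ∀ s, x s = (R3 (φ s) * R1 (θ s) * R3 (ψ s)) *ᵥ ξ s)
    (hy : y = (R3 (φ t) * R1 (θ t) * R3 (ψ t)) *ᵥ ζ) :
    y ⬝ᵥ deriv x t =
        (crossProduct (x t) y ⬝ᵥ e3) * deriv φ t
      + (crossProduct (x t) y ⬝ᵥ R3 (φ t) *ᵥ e1) * deriv θ t
      + (crossProduct (x t) y ⬝ᵥ (R3 (φ t) * R1 (θ t)) *ᵥ e3) * deriv ψ t
      + ζ ⬝ᵥ deriv ξ t := by
  have hd := hφ.hasDerivAt.R3_mulVec (hθ.hasDerivAt.R1_mulVec (hψ.hasDerivAt.R3_mulVec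
    hξ.hasDerivAt))
  simp only [← mulVec_mulVec] at hx hy
  rw [← funext hx] at hd
  have triple (u : Fin 3 → ℝ) : y ⬝ᵥ crossProduct u (x t) = crossProduct (x t) y ⬝ᵥ u := by
    rw [triple_product_permutation, dotProduct_comm]
  have hdot : y ⬝ᵥ R3 (φ t) *ᵥ R1 (θ t) *ᵥ R3 (ψ t) *ᵥ deriv ξ t = ζ ⬝ᵥ deriv ξ t := by
    rw [hy, R3_mulVec_dotProduct_R3_mulVec, R1_mulVec_dotProduct_R1_mulVec,
      R3_mulVec_dotProduct_R3_mulVec]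
  rw [hd.deriv]
  simp only [mulVec_add, mulVec_smul, R1_mulVec_crossProduct, R3_mulVec_crossProduct, ← hx,
    dotProduct_add, dotProduct_smul, triple, hdot, smul_eq_mul, ← mulVec_mulVec]
  ring

theorem stmt1 (n : ℕ) (hn : 1 ≤ n) (φ θ ψ : ℝ → ℝ)
    (hφ : Differentiable ℝ φ) (hθ : Differentiable ℝ θ) (hψ : Differentiable ℝ ψ)
    (ξ ζ : Fin n → ℝ → Fin 3 → ℝ)
    (hξ : ∀ j, Differentiable ℝ (ξ j)) (hζ : ∀ j, Differentiable ℝ (ζ j))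
    (ℛ : ℝ → Matrix (Fin 3) (Fin 3) ℝ)
    (hℛ : ∀ t, ℛ t = R3 (φ t) * R1 (θ t) * R3 (ψ t))
    (x y : Fin n → ℝ → Fin 3 → ℝ)
    (hx : ∀ j t, x j t = (ℛ t).mulVec (ξ j t))
    (hy : ∀ j t, y j t = (ℛ t).mulVec (ζ j t))
    (C : ℝ → Fin 3 → ℝ)
    (hC : ∀ t, C t = ∑ j, crossProduct (x j t) (y j t)) :
    ∀ t, ∑ j, y j t ⬝ᵥ deriv (x j) t =
        (C t ⬝ᵥ e3) * deriv φ t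
      + (C t ⬝ᵥ (R3 (φ t)).mulVec e1) * deriv θ t
      + (C t ⬝ᵥ (R3 (φ t) * R1 (θ t)).mulVec e3) * deriv ψ t
      + ∑ j, ζ j t ⬝ᵥ deriv (ξ j) t := by
  intro t
  have h j := dotProduct_deriv_euler_mulVec (hφ t) (hθ t) (hψ t) (hξ j t) (ζ j t)
    (fun s => (hx j s).trans (by rw [hℛ])) ((hy j t).trans (by rw [hℛ]))
  simp only [h, hC, sum_dotProduct, Finset.sum_add_distrib, Finset.sum_mul]
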